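/- There exists an absolute constant C > 0 such that for every nonnegative ω ∈ L¹(Π) ∩ L²(Π) that is Steiner symmetric in x₁, and for every x = (x₁,x₂) ∈ Π with |x₁| > 4, one has 𝒢ω(x) ≤ C ( |x₁|^{−3/8} ‖ω‖_{L¹(Π)}^{1/2} ‖ω‖_{L²(Π)}^{1/2} + e^{−√{|x₁|}/2} ‖ω‖_{L¹(Π)} ). -/

import Mathlib

open MeasureTheory Real Filter

noncomputable section

/-- The upper half plane `Π = {x ∈ ℝ² : x₂ > 0}`. -/
def UHP : Set (ℝ × ℝ) := {x | 0 < x.2}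

/-- Euclidean norm of a point of `ℝ²`. -/
def rad (x : ℝ × ℝ) : ℝ := Real.sqrt (x.1 ^ 2 + x.2 ^ 2)

/-- Modified Bessel function of the second kind of order `0`:
`K₀(r) = ∫₀^∞ exp(-r cosh t) dt`. -/
def K0 (r : ℝ) : ℝ := ∫ t in Set.Ioi (0 : ℝ), Real.exp (-(r * Real.cosh t))

/-- Fundamental solution `G(x,y) = (1/2π) K₀(|x-y|)` of `−Δ + Id` on `ℝ²`. -/
def Gker (x y : ℝ × ℝ) : ℝ := (1 / (2 * Real.pi)) * K0 (rad (x - y))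

/-- Reflection `x̄ = (x₁, −x₂)` across the `x₁`-axis. -/
def reflPt (x : ℝ × ℝ) : ℝ × ℝ := (x.1, -x.2)

/-- Green's function `G_Π(x,y) = G(x,y) − G(x̄,y)` of `−Δ + Id` on the half plane. -/
def GUHP (x y : ℝ × ℝ) : ℝ := Gker x y - Gker (reflPt x) y

/-- The operator `𝒢ω(x) = ∫_Π G_Π(x,y) ω(y) dy`. -/
def Gop (ω : ℝ × ℝ → ℝ) (x : ℝ × ℝ) : ℝ := ∫ y in UHP, GUHP x y * ω y

/-- Kinetic energy `E(ω) = (1/2) ∫_Π ω 𝒢ω`. -/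
def kineticE (ω : ℝ × ℝ → ℝ) : ℝ := (1 / 2) * ∫ x in UHP, ω x * Gop ω x

/-- Impulse `I(ω) = ∫_Π x₂ ω dx`. -/
def impulse (ω : ℝ × ℝ → ℝ) : ℝ := ∫ x in UHP, x.2 * ω x

/-- `L¹(Π)` norm. -/
def normL1 (f : ℝ × ℝ → ℝ) : ℝ := ∫ x in UHP, |f x|

/-- `L²(Π)` norm. -/
def normL2 (f : ℝ × ℝ → ℝ) : ℝ := (∫ x in UHP, (f x) ^ 2) ^ ((1 : ℝ) / 2)

/-- `L^s(Π)` norm. -/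
def normLs (s : ℝ) (f : ℝ × ℝ → ℝ) : ℝ := (∫ x in UHP, |f x| ^ s) ^ (1 / s)

/-- Nonnegative member of `L¹(Π) ∩ L²(Π)`. -/
def NonnegL1L2 (ω : ℝ × ℝ → ℝ) : Prop :=
  (∀ x ∈ UHP, 0 ≤ ω x) ∧ IntegrableOn ω UHP ∧ IntegrableOn (fun x => (ω x) ^ 2) UHP

/-- Steiner symmetry in the `x₁` variable. -/
def SteinerSym (f : ℝ × ℝ → ℝ) : Prop :=
  (∀ x : ℝ × ℝ, f (-x.1, x.2) = f x) ∧
  ∀ x₂ : ℝ, 0 < x₂ → AntitoneOn (fun x₁ => f (x₁, x₂)) (Set.Ioi (0 : ℝ))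

/-- The admissible class `𝒜_{μ,ν}`. -/
def InAdm (μ ν : ℝ) (ω : ℝ × ℝ → ℝ) : Prop :=
  (∀ x ∈ UHP, 0 ≤ ω x) ∧ IntegrableOn ω UHP ∧ IntegrableOn (fun x => (ω x) ^ 2) UHP ∧
  IntegrableOn (fun x => x.2 * ω x) UHP ∧
  impulse ω = μ ∧ (∫ x in UHP, ω x) ≤ ν

/-- The energy functional `ℰ_λ(ω) = E(ω) − (1/(2λ)) ∫_Π ω²`. -/
def Efun (lam : ℝ) (ω : ℝ × ℝ → ℝ) : ℝ :=
  kineticE ω - (1 / (2 * lam)) * ∫ x in UHP, (ω x) ^ 2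

/-- The supremum `S_{μ,ν,λ} = sup_{ω ∈ 𝒜_{μ,ν}} ℰ_λ(ω)`. -/
def Sval (lam μ ν : ℝ) : ℝ := sSup {s | ∃ ω, InAdm μ ν ω ∧ s = Efun lam ω}

/-- `ω` is a maximizer, i.e. `ω ∈ Σ_{μ,ν,λ}`. -/
def IsMaximizer (lam μ ν : ℝ) (ω : ℝ × ℝ → ℝ) : Prop :=
  InAdm μ ν ω ∧ Efun lam ω = Sval lam μ ν

/-- Bessel function of the first kind of order one. -/
def J1 (r : ℝ) : ℝ :=
  ∑' k : ℕ, ((-1 : ℝ) ^ k / ((Nat.factorial k : ℝ) * (Nat.factorial (k + 1) : ℝ))) *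
    (r / 2) ^ (2 * k + 1)

/-- Modified Bessel function of the second kind of order one. -/
def K1 (r : ℝ) : ℝ := ∫ t in Set.Ioi (0 : ℝ), Real.exp (-(r * Real.cosh t)) * Real.cosh t

/-- The set of `t > 0` with `J₁(√(λ−1) t) ≠ 0` solving the transcendental equation
`t (K₁'(t)/K₁(t) + (λ−1)^{-1/2} J₁'(√(λ−1)t)/J₁(√(λ−1)t)) = λ/(λ−1)`. -/
def aSet (lam : ℝ) : Set ℝ :=
  {t | 0 < t ∧ J1 (Real.sqrt (lam - 1) * t) ≠ 0 ∧
    t * (deriv K1 t / K1 t +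
      (1 / Real.sqrt (lam - 1)) *
        (deriv J1 (Real.sqrt (lam - 1) * t) / J1 (Real.sqrt (lam - 1) * t))) = lam / (lam - 1)}

/-- The smallest positive solution `a = a(λ)`. -/
def aLam (lam : ℝ) : ℝ := sInf (aSet lam)

/-- The stream function `Ψ_L^{λ,W}` of the Lamb dipole, written in polar coordinates
`x₁ = r cos θ`, `x₂ = r sin θ` (so that `sin θ = x₂ / r`). -/
def PsiL (lam W : ℝ) (x : ℝ × ℝ) : ℝ :=
  if rad x ≤ aLam lam then
    ((-(W * aLam lam / (lam - 1)) / J1 (Real.sqrt (lam - 1) * aLam lam)) *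
        J1 (Real.sqrt (lam - 1) * rad x) + (W * lam / (lam - 1)) * rad x) * (x.2 / rad x)
  else (W * aLam lam / K1 (aLam lam)) * K1 (rad x) * (x.2 / rad x)

/-- The Lamb dipole `ω_L^{λ,W} = λ (Ψ_L^{λ,W} − W x₂)₊` restricted to `Π`. -/
def omegaL (lam W : ℝ) (x : ℝ × ℝ) : ℝ :=
  if 0 < x.2 then lam * max (PsiL lam W x - W * x.2) 0 else 0

/-- `ϱ(λ) = (∫_Π ω_L^{λ,1} dx) / I(ω_L^{λ,1})`. -/
def varrho (lam : ℝ) : ℝ := (∫ x in UHP, omegaL lam 1 x) / impulse (omegaL lam 1)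

/-- The Laplacian on `ℝ²`, written coordinatewise. -/
def lap (ψ : ℝ × ℝ → ℝ) (x : ℝ × ℝ) : ℝ :=
  deriv (deriv fun t => ψ (t, x.2)) x.1 + deriv (deriv fun t => ψ (x.1, t)) x.2

/-- Distance (in `L¹ ∩ L²` plus weighted `L¹`) from `ζ` to a set of functions `S`. -/
def distToSet (S : Set ((ℝ × ℝ) → ℝ)) (ζ : (ℝ × ℝ) → ℝ) : ℝ :=
  sInf {d | ∃ ω ∈ S, d = normL1 (fun x => ζ x - ω x) + normL2 (fun x => ζ x - ω x) +
    normL1 (fun x => x.2 * (ζ x - ω x))}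

end


/-- bound -/
noncomputable def Bd (r : ℝ) : ℝ := 8 * r ^ (-(1/4) : ℝ) * Real.exp (-(r/2))

theorem K0_nonneg (r : ℝ) : 0 ≤ K0 r := by
  unfold K0
  exact integral_nonneg fun t => (Real.exp_pos _).le

theorem Bd_nonneg {r : ℝ} (hr : 0 ≤ r) : 0 ≤ Bd r := by
  unfold Bd; positivity

theorem ptK {r : ℝ} (hr : 0 < r) (t : ℝ) (_ht : 0 < t) :
    Real.exp (-(r * Real.cosh t)) ≤ (2 * r ^ (-(1/4) : ℝ) * Real.exp (-(r/2))) * Real.exp (-(1/4) * t) := by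
  have h1 : 1 ≤ Real.cosh t := Real.one_le_cosh t
  have h2 : Real.exp t / 2 ≤ Real.cosh t := by
    rw [Real.cosh_eq]; have := Real.exp_pos (-t); linarith
  have hu : 0 < r * (Real.exp t / 2) := by positivity
  have h3 : Real.exp (-(r * Real.cosh t)) ≤ Real.exp (-(r/2)) * Real.exp (-(r * (Real.exp t / 2)) / 2) := by
    rw [← Real.exp_add]
    apply Real.exp_le_exp.2
    nlinarith
  have h4 : Real.exp (-(r * (Real.exp t / 2)) / 2) ≤ (r * (Real.exp t / 2)) ^ (-(1/4) : ℝ) := by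
    set u := r * (Real.exp t / 2)
    have : Real.exp (-u / 2) = (Real.exp (2*u)) ^ (-(1/4) : ℝ) := by
      rw [← Real.exp_mul]; congr 1; ring
    rw [this]
    apply Real.rpow_le_rpow_of_nonpos hu
    · have := Real.add_one_le_exp (2*u); linarith
    · norm_num
  have h5 : (r * (Real.exp t / 2)) ^ (-(1/4) : ℝ) ≤ 2 * r ^ (-(1/4) : ℝ) * Real.exp (-(1/4) * t) := by
    rw [Real.mul_rpow hr.le (by positivity), div_eq_mul_inv (Real.exp t), Real.mul_rpow (by positivity) (by positivity), ← Real.exp_mul]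
    have : ((2:ℝ)⁻¹) ^ (-(1/4) : ℝ) ≤ 2 := by
      rw [Real.inv_rpow (by norm_num), Real.rpow_neg (by norm_num), inv_inv]
      calc (2:ℝ) ^ (1/4 : ℝ) ≤ 2 ^ (1:ℝ) := Real.rpow_le_rpow_of_exponent_le (by norm_num) (by norm_num)
        _ = 2 := by simp
    have e : t * -(1/4) = -(1/4) * t := by ring
    rw [e]
    have hp : 0 < r ^ (-(1/4) : ℝ) * Real.exp (-(1/4) * t) := by positivity
    nlinarith
  have hp := Real.exp_pos (-(r/2))
  calc _ ≤ _ := h3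
    _ ≤ Real.exp (-(r/2)) * (2 * r ^ (-(1/4) : ℝ) * Real.exp (-(1/4) * t)) := by
        gcongr; exact h4.trans h5
    _ = _ := by ring

theorem K0_le {r : ℝ} (hr : 0 ≤ r) : K0 r ≤ Bd r := by
  rcases hr.eq_or_lt with rfl | hr
  · have : K0 0 = 0 := by
      unfold K0
      simp [integral_const, Measure.real]
    rw [this]; exact Bd_nonneg le_rfl
  · unfold K0
    calc _ ≤ ∫ t in Set.Ioi (0:ℝ), (2 * r ^ (-(1/4) : ℝ) * Real.exp (-(r/2))) * Real.exp (-(1/4) * t) := by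
          apply integral_mono_of_nonneg
          · exact Eventually.of_forall fun t => (Real.exp_pos _).le
          · exact (exp_neg_integrableOn_Ioi 0 (by norm_num : (0:ℝ) < 1/4)).const_mul _
          · filter_upwards [self_mem_ae_restrict measurableSet_Ioi] with t ht using ptK hr t ht
      _ = Bd r := by
          rw [integral_const_mul, integral_exp_mul_Ioi (by norm_num)]
          unfold Bd; norm_num; ring

theorem rad_nonneg (x : ℝ × ℝ) : 0 ≤ rad x := Real.sqrt_nonneg _

theorem GUHP_le (x y : ℝ × ℝ) : GUHP x y ≤ Bd (rad (x - y)) := by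
  unfold GUHP Gker
  have h1 := K0_nonneg (rad (x - y))
  have h2 := K0_nonneg (rad (reflPt x - y))
  have h3 := K0_le (rad_nonneg (x-y))
  have hp : 1 / (2 * Real.pi) ≤ 1 := by
    rw [div_le_one (by positivity)]; have := Real.pi_gt_three; linarith
  have hp' : 0 ≤ 1 / (2 * Real.pi) := by positivity
  nlinarith [mul_nonneg hp' h2]

theorem meas_B (x : ℝ × ℝ) : Measurable fun y => ENNReal.ofReal (Bd (rad (x - y))) := by
  unfold Bd rad
  fun_prop

theorem phi_integrable : Integrable (fun a : ℝ => Real.exp (-|a|) * |a| ^ ((1/2 : ℝ) - 1)) := by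
  by_contra hcon
  have h1 := integral_comp_abs (f := fun a : ℝ => Real.exp (-a) * a ^ ((1/2 : ℝ) - 1))
  rw [integral_undef hcon, ← Real.Gamma_eq_integral (by norm_num)] at h1
  have := Real.Gamma_pos_of_pos (by norm_num : (0:ℝ) < 1/2)
  linarith

theorem Bd_four_le (y : ℝ × ℝ) (h1 : y.1 ≠ 0) (h2 : y.2 ≠ 0) :
    (Bd (rad y)) ^ 4 ≤ 4096 * ((Real.exp (-|y.1|) * |y.1| ^ ((1/2 : ℝ) - 1)) *
      (Real.exp (-|y.2|) * |y.2| ^ ((1/2 : ℝ) - 1))) := by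
  have ha : 0 < |y.1| := abs_pos.2 h1
  have hb : 0 < |y.2| := abs_pos.2 h2
  have hr : 0 < rad y := Real.sqrt_pos.2 (by positivity)
  have hsq : rad y ^ 2 = |y.1| ^ 2 + |y.2| ^ 2 := by
    rw [sq_abs, sq_abs]; exact Real.sq_sqrt (by positivity)
  set a := |y.1|
  set b := |y.2|
  set r := rad y
  have hab : a * b ≤ r ^ 2 := by nlinarith [sq_nonneg (a - b)]
  have hsum : a + b ≤ 2 * r := by
    apply le_of_sq_le_sq _ (by positivity)
    nlinarith [sq_nonneg (a - b)]
  have e1 : (Bd r) ^ 4 = 4096 * (r⁻¹ * Real.exp (-(2 * r))) := by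
    unfold Bd
    rw [mul_pow, mul_pow, ← Real.exp_nat_mul, ← Real.rpow_natCast (r ^ _), ← Real.rpow_mul hr.le]
    norm_num
    rw [Real.rpow_neg_one]
    ring_nf
  have e2 : r⁻¹ ≤ a ^ ((1/2 : ℝ) - 1) * b ^ ((1/2 : ℝ) - 1) := by
    rw [← Real.mul_rpow ha.le hb.le]
    have : r⁻¹ = (r ^ 2) ^ ((1/2 : ℝ) - 1) := by
      rw [← Real.rpow_natCast, ← Real.rpow_mul hr.le]
      norm_num
      rw [Real.rpow_neg_one]
    rw [this]
    exact Real.rpow_le_rpow_of_nonpos (by positivity) hab (by norm_num)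
  have e3 : Real.exp (-(2 * r)) ≤ Real.exp (-a) * Real.exp (-b) := by
    rw [← Real.exp_add]; apply Real.exp_le_exp.2; linarith
  rw [e1]
  calc 4096 * (r⁻¹ * Real.exp (-(2 * r)))
      ≤ 4096 * ((a ^ ((1/2 : ℝ) - 1) * b ^ ((1/2 : ℝ) - 1)) * (Real.exp (-a) * Real.exp (-b))) := by
        gcongr
    _ = _ := by ring

theorem Q_finite : ∫⁻ y : ℝ × ℝ, ENNReal.ofReal (Bd (rad y)) ^ (4:ℝ) ≠ ⊤ := by
  have hint : Integrable (fun y : ℝ × ℝ => 4096 * ((Real.exp (-|y.1|) * |y.1| ^ ((1/2 : ℝ) - 1)) *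
      (Real.exp (-|y.2|) * |y.2| ^ ((1/2 : ℝ) - 1)))) :=
    (Integrable.mul_prod phi_integrable phi_integrable).const_mul 4096
  refine ne_top_of_le_ne_top hint.lintegral_lt_top.ne ?_
  apply lintegral_mono_ae
  have n1 : ∀ᵐ y : ℝ × ℝ, y.1 ≠ 0 :=
    Measure.quasiMeasurePreserving_fst.ae (Measure.ae_ne volume (0:ℝ))
  have n2 : ∀ᵐ y : ℝ × ℝ, y.2 ≠ 0 :=
    Measure.quasiMeasurePreserving_snd.ae (Measure.ae_ne volume (0:ℝ))
  filter_upwards [n1, n2] with y h1 h2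
  have : ENNReal.ofReal (Bd (rad y)) ^ (4:ℝ) = ENNReal.ofReal (Bd (rad y) ^ 4) := by
    rw [ENNReal.ofReal_pow (Bd_nonneg (rad_nonneg _)), ← ENNReal.rpow_natCast]; norm_num
  rw [this]
  exact ENNReal.ofReal_le_ofReal (Bd_four_le y h1 h2)

theorem strip {h : ℝ × ℝ → ENNReal} (hm : AEMeasurable h (volume.restrict UHP))
    (hanti : ∀ a b s : ℝ, 0 < b → 0 < s → s ≤ |a| → h (a, b) ≤ h (s, b))
    {m : ℝ} {I : Set ℝ} (hI : MeasurableSet I) (hIm : ∀ a ∈ I, m ≤ |a|) :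
    ENNReal.ofReal m * ∫⁻ y in I ×ˢ Set.Ioi 0, h y ≤ volume I * ∫⁻ y in UHP, h y := by
  have hsub : Set.Ioc 0 m ×ˢ Set.Ioi (0:ℝ) ⊆ UHP := fun y hy => hy.2
  have hm2 : AEMeasurable h (volume.restrict (Set.Ioc 0 m ×ˢ Set.Ioi (0:ℝ))) :=
    hm.mono_measure (Measure.restrict_mono hsub le_rfl)
  rw [← lintegral_const_mul' _ _ ENNReal.ofReal_ne_top]
  calc ∫⁻ y in I ×ˢ Set.Ioi 0, ENNReal.ofReal m * h y
      ≤ ∫⁻ y in I ×ˢ Set.Ioi 0, ∫⁻ s in Set.Ioc 0 m, h (s, y.2) := by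
        apply setLIntegral_mono' (hI.prod measurableSet_Ioi)
        rintro ⟨a, b⟩ ⟨ha, hb⟩
        calc ENNReal.ofReal m * h (a, b) = ∫⁻ s in Set.Ioc 0 m, h (a, b) := by
              simp [mul_comm]
          _ ≤ _ := setLIntegral_mono' measurableSet_Ioc fun s hs =>
              hanti a b s hb hs.1 (hs.2.trans (hIm a ha))
    _ ≤ ∫⁻ a in I, ∫⁻ b in Set.Ioi 0, ∫⁻ s in Set.Ioc 0 m, h (s, b) := by
        rw [Measure.volume_eq_prod, ← Measure.prod_restrict]
        exact lintegral_prod_le _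
    _ = volume I * ∫⁻ y in Set.Ioc 0 m ×ˢ Set.Ioi (0:ℝ), h y := by
        rw [Measure.volume_eq_prod, ← Measure.prod_restrict] at hm2 ⊢
        rw [lintegral_prod_symm _ hm2]
        simp [mul_comm]
    _ ≤ _ := by
        gcongr

theorem holder {μ : Measure (ℝ × ℝ)} {B w : ℝ × ℝ → ENNReal} (hB : AEMeasurable B μ)
    (hw : AEMeasurable w μ) :
    ∫⁻ y, B y * w y ∂μ ≤ (∫⁻ y, w y ∂μ) ^ (1/2 : ℝ) *
      ((∫⁻ y, B y ^ (4:ℝ) ∂μ) ^ (1/2 : ℝ) * (∫⁻ y, w y ^ (2:ℝ) ∂μ) ^ (1/2 : ℝ)) ^ (1/2 : ℝ) := by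
  have hc : (2:ℝ).HolderConjugate 2 := by
    rw [Real.holderConjugate_iff]; norm_num
  have H1 := ENNReal.lintegral_mul_le_Lp_mul_Lq μ hc (hw.pow_const (1/2:ℝ)) (hB.mul (hw.pow_const (1/2:ℝ)))
  have H2 := ENNReal.lintegral_mul_le_Lp_mul_Lq μ hc (hB.pow_const (2:ℝ)) hw
  have hh : ∀ z : ENNReal, (z ^ (1/2:ℝ)) ^ (2:ℝ) = z := fun z => by
    rw [← ENNReal.rpow_mul]; norm_num
  have h4 : ∀ z : ENNReal, (z ^ (2:ℝ)) ^ (2:ℝ) = z ^ (4:ℝ) := fun z => by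
    rw [← ENNReal.rpow_mul]; norm_num
  have hs : ∀ z : ENNReal, z ^ (1/2:ℝ) * z ^ (1/2:ℝ) = z := fun z => by
    rw [← ENNReal.rpow_add_of_nonneg _ _ (by norm_num) (by norm_num)]; norm_num
  simp only [Pi.mul_apply, hh, h4, ENNReal.mul_rpow_of_nonneg _ _ (by norm_num : (0:ℝ) ≤ 2)] at H1 H2
  calc ∫⁻ y, B y * w y ∂μ = ∫⁻ y, w y ^ (1/2:ℝ) * (B y * w y ^ (1/2:ℝ)) ∂μ := by
        refine lintegral_congr fun y => ?_
        conv_lhs => rw [← hs (w y)]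
        ring
    _ ≤ _ := H1.trans (by gcongr)

theorem far_bound {r R : ℝ} (hR : 1 ≤ R) (hr : R ≤ r) : Bd r ≤ 8 * Real.exp (-R / 2) := by
  unfold Bd
  have h1 : r ^ (-(1/4) : ℝ) ≤ 1 := Real.rpow_le_one_of_one_le_of_nonpos (hR.trans hr) (by norm_num)
  have h2 : Real.exp (-(r/2)) ≤ Real.exp (-R/2) := Real.exp_le_exp.2 (by linarith)
  have h0 : 0 ≤ r ^ (-(1/4) : ℝ) := Real.rpow_nonneg (by linarith) _
  calc 8 * r ^ (-(1/4) : ℝ) * Real.exp (-(r/2)) ≤ 8 * 1 * Real.exp (-R/2) := by gcongr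
    _ = _ := by ring

theorem integral_le_of_lintegral {μ : Measure (ℝ × ℝ)} {f : ℝ × ℝ → ℝ} {c : ℝ} (hc : 0 ≤ c)
    (h : ∫⁻ y, ENNReal.ofReal (f y) ∂μ ≤ ENNReal.ofReal c) : ∫ y, f y ∂μ ≤ c := by
  by_cases hf : Integrable f μ
  · rw [integral_eq_lintegral_pos_part_sub_lintegral_neg_part hf]
    have := ENNReal.toReal_mono ENNReal.ofReal_ne_top h
    rw [ENNReal.toReal_ofReal hc] at this
    have h2 := ENNReal.toReal_nonneg (a := ∫⁻ y, ENNReal.ofReal (-f y) ∂μ)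
    linarith
  · rw [integral_undef hf]; exact hc

/-- decay of `𝒢ω` in `x₁` for Steiner symmetric `ω`. -/
theorem stmt4 :
    ∃ C : ℝ, 0 < C ∧ ∀ ω : ℝ × ℝ → ℝ, NonnegL1L2 ω → SteinerSym ω →
      ∀ x ∈ UHP, 4 < |x.1| →
        Gop ω x ≤ C * (|x.1| ^ (-(3 : ℝ) / 8) * normL1 ω ^ ((1 : ℝ) / 2) *
            normL2 ω ^ ((1 : ℝ) / 2) +
          Real.exp (-Real.sqrt |x.1| / 2) * normL1 ω) := by
  obtain ⟨q, hq⟩ : ∃ q : ℝ, q = (∫⁻ y : ℝ × ℝ, ENNReal.ofReal (Bd (rad y)) ^ (4:ℝ)).toReal := ⟨_, rfl⟩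
  have hq0 : 0 ≤ q := hq ▸ ENNReal.toReal_nonneg
  have hQ : ∫⁻ y : ℝ × ℝ, ENNReal.ofReal (Bd (rad y)) ^ (4:ℝ) = ENNReal.ofReal q := by
    rw [hq, ENNReal.ofReal_toReal Q_finite]
  refine ⟨4 * q ^ (1/4 : ℝ) + 8, by positivity, ?_⟩
  intro ω ⟨hpos, hi1, hi2⟩ ⟨hsym, hant⟩ x hx hx4
  have hUm : MeasurableSet UHP := measurableSet_lt measurable_const measurable_snd
  set X := |x.1| with hX
  set R := Real.sqrt X with hR
  have hRX : R ^ 2 = X := Real.sq_sqrt (by linarith)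
  have hR2 : 2 ≤ R := Real.le_sqrt_of_sq_le (by linarith)
  have hn1 : normL1 ω = ∫ y in UHP, ω y :=
    setIntegral_congr_fun hUm fun y hy => abs_of_nonneg (hpos y hy)
  have hae : 0 ≤ᵐ[volume.restrict UHP] ω := by
    filter_upwards [self_mem_ae_restrict hUm] with y hy using hpos y hy
  have hn0 : 0 ≤ normL1 ω := by rw [hn1]; exact integral_nonneg_of_ae hae
  have hN0 : 0 ≤ ∫ y in UHP, ω y ^ 2 := integral_nonneg fun y => sq_nonneg _
  have hA1 : ∫⁻ y in UHP, ENNReal.ofReal (ω y) = ENNReal.ofReal (normL1 ω) := by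
    rw [hn1, ofReal_integral_eq_lintegral_ofReal hi1 hae]
  have hA2 : ∫⁻ y in UHP, ENNReal.ofReal (ω y) ^ (2:ℝ) = ENNReal.ofReal (∫ y in UHP, ω y ^ 2) := by
    rw [ofReal_integral_eq_lintegral_ofReal hi2 (Eventually.of_forall fun y => sq_nonneg _)]
    refine setLIntegral_congr_fun hUm fun y hy => ?_
    rw [ENNReal.ofReal_pow (hpos y hy), ← ENNReal.rpow_natCast]; norm_num
  have hwm : AEMeasurable (fun y => ENNReal.ofReal (ω y)) (volume.restrict UHP) :=
    hi1.aestronglyMeasurable.aemeasurable.ennreal_ofReal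
  have hanti : ∀ a b s : ℝ, 0 < b → 0 < s → s ≤ |a| →
      ENNReal.ofReal (ω (a, b)) ≤ ENNReal.ofReal (ω (s, b)) := by
    intro a b s hb hs hsa
    apply ENNReal.ofReal_le_ofReal
    have e : ω (a, b) = ω (|a|, b) := by
      rcases abs_choice a with h | h
      · rw [h]
      · rw [h]; exact (hsym (a, b)).symm
    rw [e]
    exact hant b hb (Set.mem_Ioi.2 hs) (Set.mem_Ioi.2 (hs.trans_le hsa)) hsa
  have hI : MeasurableSet (Metric.ball x.1 R) := measurableSet_ball
  have hIm : ∀ a ∈ Metric.ball x.1 R, X / 2 ≤ |a| := by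
    intro a ha
    rw [Metric.mem_ball, Real.dist_eq, abs_sub_comm] at ha
    have := abs_sub_abs_le_abs_sub x.1 a
    nlinarith
  have hvol : volume (Metric.ball x.1 R) = ENNReal.ofReal (2 * R) := Real.volume_ball _ _
  have key : ∀ (W : ENNReal) (n : ℝ), 0 ≤ n →
      ENNReal.ofReal (X / 2) * W ≤ ENNReal.ofReal (2 * R) * ENNReal.ofReal n →
      W ≤ ENNReal.ofReal (4 / R * n) := by
    intro W n hn h
    have hX2 : 0 < X / 2 := by linarith
    have e : ENNReal.ofReal (2 * R) * ENNReal.ofReal n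
        = ENNReal.ofReal (X / 2) * ENNReal.ofReal (4 / R * n) := by
      rw [← ENNReal.ofReal_mul (by positivity), ← ENNReal.ofReal_mul hX2.le]
      congr 1
      rw [← hRX]; field_simp; ring
    rw [e] at h
    exact (ENNReal.mul_le_mul_iff_right (ENNReal.ofReal_pos.2 hX2).ne' ENNReal.ofReal_ne_top).1 h
  set S := Metric.ball x.1 R ×ˢ Set.Ioi (0:ℝ) with hS
  have hSm : MeasurableSet S := hI.prod measurableSet_Ioi
  have hW1 : ∫⁻ y in S, ENNReal.ofReal (ω y) ≤ ENNReal.ofReal (4 / R * normL1 ω) := by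
    apply key _ _ hn0
    have := strip hwm hanti hI hIm
    rwa [hvol, hA1] at this
  have hW2 : ∫⁻ y in S, ENNReal.ofReal (ω y) ^ (2:ℝ) ≤ ENNReal.ofReal (4 / R * ∫ y in UHP, ω y ^ 2) := by
    apply key _ _ hN0
    have := strip (hwm.pow_const (2:ℝ)) (fun a b s hb hs hsa =>
      ENNReal.rpow_le_rpow (hanti a b s hb hs hsa) (by norm_num)) hI hIm
    rwa [hvol, hA2] at this
  have hSU : S ⊆ UHP := fun y hy => hy.2
  have hB4 : ∫⁻ y in S, ENNReal.ofReal (Bd (rad (x - y))) ^ (4:ℝ) ≤ ENNReal.ofReal q := by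
    refine (setLIntegral_le_lintegral _ _).trans ?_
    rw [← hQ]
    exact (lintegral_sub_left_eq_self (fun y => ENNReal.ofReal (Bd (rad y)) ^ (4:ℝ)) x).le
  set N2 := ∫ y in UHP, ω y ^ 2 with hN2
  set n1 := normL1 ω with hn1'
  have hp0 : 0 ≤ 4 / R := by positivity
  have near : ∫⁻ y in S, ENNReal.ofReal (Bd (rad (x - y))) * ENNReal.ofReal (ω y) ≤
      ENNReal.ofReal (4 * q ^ (1/4 : ℝ) * (X ^ (-(3 : ℝ) / 8) * n1 ^ ((1 : ℝ) / 2) *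
            normL2 ω ^ ((1 : ℝ) / 2))) := by
    refine (holder (meas_B x).aemeasurable
      (hwm.mono_measure (Measure.restrict_mono hSU le_rfl))).trans ?_
    calc _ ≤ ENNReal.ofReal (4 / R * n1) ^ (1/2 : ℝ) * (ENNReal.ofReal q ^ (1/2 : ℝ) *
          ENNReal.ofReal (4 / R * N2) ^ (1/2 : ℝ)) ^ (1/2 : ℝ) := by gcongr
      _ = ENNReal.ofReal ((4 / R * n1) ^ (1/2 : ℝ) * (q ^ (1/2 : ℝ) *
          (4 / R * N2) ^ (1/2 : ℝ)) ^ (1/2 : ℝ)) := by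
        rw [ENNReal.ofReal_rpow_of_nonneg (by positivity) (by norm_num),
          ENNReal.ofReal_rpow_of_nonneg (by positivity) (by norm_num),
          ENNReal.ofReal_rpow_of_nonneg (by positivity) (by norm_num),
          ← ENNReal.ofReal_mul (by positivity),
          ENNReal.ofReal_rpow_of_nonneg (by positivity) (by norm_num),
          ← ENNReal.ofReal_mul (by positivity)]
      _ ≤ _ := by
        apply ENNReal.ofReal_le_ofReal
        have e1 : (4 / R * n1) ^ (1/2 : ℝ) = (4 / R) ^ (1/2 : ℝ) * n1 ^ (1/2 : ℝ) :=
          Real.mul_rpow hp0 hn0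
        have e2 : (q ^ (1/2 : ℝ) * (4 / R * N2) ^ (1/2 : ℝ)) ^ (1/2 : ℝ)
            = q ^ (1/4 : ℝ) * ((4 / R) ^ (1/4 : ℝ) * (normL2 ω) ^ (1/2 : ℝ)) := by
          rw [Real.mul_rpow hp0 hN0, Real.mul_rpow (by positivity) (by positivity),
            Real.mul_rpow (by positivity) (by positivity), ← Real.rpow_mul hq0, ← Real.rpow_mul hp0]
          norm_num [normL2, hN2]
        have e3 : (4 / R) ^ (1/2 : ℝ) * (4 / R) ^ (1/4 : ℝ) ≤ 4 * X ^ (-(3 : ℝ) / 8) := by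
          rw [← Real.rpow_add (by positivity), Real.div_rpow (by norm_num) (by positivity),
            div_eq_mul_inv, ← Real.rpow_neg (by positivity)]
          have f1 : (4:ℝ) ^ (1/2 + 1/4 : ℝ) ≤ 4 := by
            calc (4:ℝ) ^ (1/2 + 1/4 : ℝ) ≤ 4 ^ (1:ℝ) :=
                  Real.rpow_le_rpow_of_exponent_le (by norm_num) (by norm_num)
              _ = 4 := by simp
          have f2 : R ^ (-(1/2 + 1/4) : ℝ) = X ^ (-(3 : ℝ) / 8) := by
            rw [← hRX, ← Real.rpow_natCast, ← Real.rpow_mul (by positivity)]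
            norm_num
          rw [f2]
          gcongr
        rw [e1, e2]
        have hL : 0 ≤ normL2 ω := Real.rpow_nonneg hN0 _
        calc _ = ((4 / R) ^ (1/2 : ℝ) * (4 / R) ^ (1/4 : ℝ)) * (n1 ^ (1/2 : ℝ) * q ^ (1/4 : ℝ) *
              normL2 ω ^ (1/2 : ℝ)) := by ring
          _ ≤ (4 * X ^ (-(3 : ℝ) / 8)) * (n1 ^ (1/2 : ℝ) * q ^ (1/4 : ℝ) *
              normL2 ω ^ (1/2 : ℝ)) := by gcongr
          _ = _ := by ring
  have far : ∫⁻ y in UHP \ S, ENNReal.ofReal (Bd (rad (x - y))) * ENNReal.ofReal (ω y) ≤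
      ENNReal.ofReal (8 * (Real.exp (-R / 2) * n1)) := by
    calc _ ≤ ∫⁻ y in UHP \ S, ENNReal.ofReal (8 * Real.exp (-R / 2)) * ENNReal.ofReal (ω y) := by
          apply setLIntegral_mono' (hUm.diff hSm)
          rintro y ⟨hy1, hy2⟩
          gcongr
          apply far_bound (by linarith)
          have hy3 : R ≤ |x.1 - y.1| := by
            by_contra hcon
            apply hy2
            refine ⟨?_, hy1⟩
            rw [Metric.mem_ball, Real.dist_eq, abs_sub_comm]
            exact not_le.1 hcon
          refine hy3.trans ?_
          apply Real.abs_le_sqrt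
          have := sq_nonneg (x - y).2
          simp only [Prod.fst_sub]
          linarith
      _ ≤ ∫⁻ y in UHP, ENNReal.ofReal (8 * Real.exp (-R / 2)) * ENNReal.ofReal (ω y) :=
          lintegral_mono_set Set.sdiff_subset
      _ = _ := by
          rw [lintegral_const_mul' _ _ ENNReal.ofReal_ne_top, hA1,
            ← ENNReal.ofReal_mul (by positivity), mul_assoc]
  have hL : 0 ≤ normL2 ω := Real.rpow_nonneg hN0 _
  have hX0 : 0 ≤ X := abs_nonneg _
  have hT1 : 0 ≤ X ^ (-(3 : ℝ) / 8) * n1 ^ ((1 : ℝ) / 2) * normL2 ω ^ ((1 : ℝ) / 2) := by positivity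
  have hT2 : 0 ≤ Real.exp (-R / 2) * n1 := by positivity
  have hq4 : 0 ≤ q ^ (1/4 : ℝ) := by positivity
  unfold Gop
  apply integral_le_of_lintegral (by positivity)
  calc ∫⁻ y in UHP, ENNReal.ofReal (GUHP x y * ω y)
      ≤ ∫⁻ y in UHP, ENNReal.ofReal (Bd (rad (x - y))) * ENNReal.ofReal (ω y) := by
        apply setLIntegral_mono' hUm
        intro y hy
        rw [← ENNReal.ofReal_mul (Bd_nonneg (rad_nonneg _))]
        exact ENNReal.ofReal_le_ofReal (mul_le_mul_of_nonneg_right (GUHP_le x y) (hpos y hy))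
    _ = (∫⁻ y in S, ENNReal.ofReal (Bd (rad (x - y))) * ENNReal.ofReal (ω y)) +
        ∫⁻ y in UHP \ S, ENNReal.ofReal (Bd (rad (x - y))) * ENNReal.ofReal (ω y) := by
        rw [← lintegral_inter_add_sdiff _ UHP hSm, Set.inter_eq_self_of_subset_right hSU]
    _ ≤ _ := add_le_add near far
    _ ≤ _ := by
        rw [← ENNReal.ofReal_add (by positivity) (by positivity)]
        apply ENNReal.ofReal_le_ofReal
        nlinarith [mul_nonneg hq4 hT2]
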